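/- Let G be a quasiassociative quasigroup and set H := N(G) × G with product (n,g) ⊗ (m,h) := (n·Ad_g(m), g·h) and inverse (n,g)⁻¹ := (Ad_{g⁻¹}(n⁻¹), g⁻¹). Then (1,1) is a two-sided unit for ⊗, and for all (n,g), (m,h) ∈ H: ((n,g) ⊗ (m,h)) ⊗ (m,h)⁻¹ = (n,g) and (n,g)⁻¹ ⊗ ((n,g) ⊗ (m,h)) = (m,h); in particular H is a quasigroup. -/

import Mathlib

/-- A quasigroup (in the sense of the paper): a type with a multiplication,
a two-sided identity, and an inverse operation satisfying
`g⁻¹ * (g * h) = h` and `(h * g⁻¹) * g = h`. -/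
class PaperQuasigroup (G : Type*) extends Mul G, One G, Inv G where
  one_mul : ∀ g : G, 1 * g = g
  mul_one : ∀ g : G, g * 1 = g
  inv_mul_cancel_left : ∀ g h : G, g⁻¹ * (g * h) = h
  mul_inv_cancel_right : ∀ g h : G, (h * g⁻¹) * g = h

/-- The nucleus `N(G)` of associative elements of a quasigroup. -/
def PaperQuasigroup.nucleus (G : Type*) [PaperQuasigroup G] : Set G :=
  {a | ∀ g h : G,
    (a * g) * h = a * (g * h) ∧ (g * a) * h = g * (a * h) ∧ (g * h) * a = g * (h * a)}

/-- The multiplicative associator `β(g,h,k) = (g·(h·k))·((g·h)·k)⁻¹`. -/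
def PaperQuasigroup.associator {G : Type*} [PaperQuasigroup G] (g h k : G) : G :=
  (g * (h * k)) * ((g * h) * k)⁻¹

/-- A quasigroup is quasiassociative if the associator takes values in the nucleus
and the nucleus is stable under conjugation. -/
def PaperQuasigroup.IsQuasiassociative (G : Type*) [PaperQuasigroup G] : Prop :=
  (∀ g h k : G, PaperQuasigroup.associator g h k ∈ PaperQuasigroup.nucleus G) ∧
  (∀ g a : G, a ∈ PaperQuasigroup.nucleus G → (g * a) * g⁻¹ ∈ PaperQuasigroup.nucleus G)


/-- The adjoint action `Ad_g(a) := (g·a)·g⁻¹`. -/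
def PaperQuasigroup.Ad {G : Type*} [PaperQuasigroup G] (g a : G) : G := (g * a) * g⁻¹

open PaperQuasigroup

/-- The product on `H = N(G) × G`: `(n,g) ⊗ (m,h) := (n·Ad_g(m), g·h)`. -/
def PaperQuasigroup.otimes {G : Type*} [PaperQuasigroup G] (x y : G × G) : G × G :=
  (x.1 * Ad x.2 y.1, x.2 * y.2)

/-- The inverse on `H = N(G) × G`: `(n,g)⁻¹ := (Ad_{g⁻¹}(n⁻¹), g⁻¹)`. -/
def PaperQuasigroup.oinv {G : Type*} [PaperQuasigroup G] (x : G × G) : G × G :=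
  (Ad x.2⁻¹ x.1⁻¹, x.2⁻¹)

namespace PaperQuasigroup

variable {G : Type*} [PaperQuasigroup G]

theorem inv_mul_self (g : G) : g⁻¹ * g = 1 := by
  simpa only [PaperQuasigroup.mul_one] using PaperQuasigroup.inv_mul_cancel_left g 1

theorem inv_inv (g : G) : g⁻¹⁻¹ = g := by
  have h := PaperQuasigroup.inv_mul_cancel_left g⁻¹ g
  rwa [inv_mul_self, PaperQuasigroup.mul_one] at h

theorem mul_inv_cancel_left (g h : G) : g * (g⁻¹ * h) = h := by
  simpa only [inv_inv] using PaperQuasigroup.inv_mul_cancel_left g⁻¹ h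

theorem mul_cancel_right (g h : G) : (h * g) * g⁻¹ = h := by
  simpa only [inv_inv] using PaperQuasigroup.mul_inv_cancel_right g⁻¹ h

theorem mul_inv_self (g : G) : g * g⁻¹ = 1 := by
  simpa only [inv_inv] using inv_mul_self g⁻¹

theorem mul_mem_nucleus {a b : G} (ha : a ∈ nucleus G) (hb : b ∈ nucleus G) :
    a * b ∈ nucleus G := fun g h => by
  refine ⟨?_, ?_, ?_⟩
  · rw [(ha b g).1, (ha (b * g) h).1, (hb g h).1, (ha b (g * h)).1]
  · rw [← (ha g b).2.1, (hb (g * a) h).2.1, (ha g (b * h)).2.1, (ha b h).1]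
  · rw [← (hb (g * h) a).2.2, (ha g h).2.2, (hb g (h * a)).2.2, (hb h a).2.2]

theorem inv_mem_nucleus {a : G} (ha : a ∈ nucleus G) : a⁻¹ ∈ nucleus G := fun g h => by
  refine ⟨?_, ?_, ?_⟩
  · have e := (ha (a⁻¹ * g) h).1
    rw [mul_inv_cancel_left] at e
    rw [e, PaperQuasigroup.inv_mul_cancel_left]
  · have e := (ha (g * a⁻¹) (a⁻¹ * h)).2.1
    rwa [mul_inv_cancel_left, PaperQuasigroup.mul_inv_cancel_right, eq_comm] at e
  · have e := (ha g (h * a⁻¹)).2.2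
    rw [PaperQuasigroup.mul_inv_cancel_right] at e
    rw [← e, mul_cancel_right]

theorem Ad_mul_self (g a : G) : Ad g a * g = g * a :=
  PaperQuasigroup.mul_inv_cancel_right g (g * a)

theorem Ad_eq_of_mul_eq {g a b : G} (h : b * g = g * a) : Ad g a = b := by
  rw [Ad, ← h, mul_cancel_right]

theorem Ad_one_left (a : G) : Ad 1 a = a :=
  Ad_eq_of_mul_eq (by rw [PaperQuasigroup.mul_one, PaperQuasigroup.one_mul])

theorem Ad_one_right (g : G) : Ad g 1 = 1 :=
  Ad_eq_of_mul_eq (by rw [PaperQuasigroup.mul_one, PaperQuasigroup.one_mul])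

theorem Ad_mul_right (hG : IsQuasiassociative G) (g : G) {a b : G} (ha : a ∈ nucleus G)
    (hb : b ∈ nucleus G) : Ad g (a * b) = Ad g a * Ad g b := by
  have hg : Ad g a ∈ nucleus G := hG.2 g a ha
  apply Ad_eq_of_mul_eq
  rw [(hg (Ad g b) g).1, Ad_mul_self, ← (hb (Ad g a) g).2.2,
    Ad_mul_self, (hb g a).2.2]

theorem Ad_mul_left (hG : IsQuasiassociative G) (g h : G) {a : G} (ha : a ∈ nucleus G) :
    Ad (g * h) a = Ad g (Ad h a) := by
  have hh : Ad h a ∈ nucleus G := hG.2 h a ha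
  have hg : Ad g (Ad h a) ∈ nucleus G := hG.2 g _ hh
  apply Ad_eq_of_mul_eq
  rw [← (hg g h).1, Ad_mul_self, (hh g h).2.1,
    Ad_mul_self, (ha g h).2.2]

end PaperQuasigroup

/-- For a quasiassociative quasigroup `G`, the set `H = N(G) × G` with the product `⊗`
and the inverse above is a quasigroup with unit `(1,1)`: it is closed under the
operations, `(1,1)` is a two-sided unit, and the quasigroup inverse laws hold. -/
theorem quasiassociative_semidirect_quasigroup {G : Type*} [PaperQuasigroup G]
    (hG : IsQuasiassociative G) (n m g h : G)
    (hn : n ∈ nucleus G) (hm : m ∈ nucleus G) :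
    ((otimes (n, g) (m, h)).1 ∈ nucleus G ∧ (oinv (n, g)).1 ∈ nucleus G) ∧
    (otimes (1, 1) (m, h) = (m, h) ∧ otimes (n, g) (1, 1) = (n, g)) ∧
    otimes (otimes (n, g) (m, h)) (oinv (m, h)) = (n, g) ∧
    otimes (oinv (n, g)) (otimes (n, g) (m, h)) = (m, h) := by
  have hAd : ∀ (k : G) {a : G}, a ∈ nucleus G → Ad k a ∈ nucleus G := fun k a ha => hG.2 k a ha
  have hn' := inv_mem_nucleus hn
  have hm' := inv_mem_nucleus hm
  refine ⟨⟨mul_mem_nucleus hn (hAd g hm), hAd g⁻¹ hn'⟩, ⟨?_, ?_⟩, ?_, ?_⟩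
  · simp only [otimes, Ad_one_left, PaperQuasigroup.one_mul]
  · simp only [otimes, Ad_one_right, PaperQuasigroup.mul_one]
  · simp only [otimes, oinv]
    rw [← Ad_mul_left hG _ _ hm', mul_cancel_right, (hn _ _).1, ← Ad_mul_right hG g hm hm',
      mul_inv_self, Ad_one_right, PaperQuasigroup.mul_one]
  · simp only [otimes, oinv]
    rw [← Ad_mul_right hG _ hn' (mul_mem_nucleus hn (hAd g hm)),
      PaperQuasigroup.inv_mul_cancel_left, ← Ad_mul_left hG _ _ hm, inv_mul_self, Ad_one_left,
      PaperQuasigroup.inv_mul_cancel_left]
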